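/- Let d ≥ 1, let X be a finite index set, let (a_x)_{x ∈ X} be an orthonormal basis of ℂ^d ⊗ ℂ^d, let p : X → ℝ with p x ≥ 0 for all x, let s : X → X be an involution with p(s x) = p x for all x, and suppose that for each x there is a phase θ_x ∈ ℝ with S(a_x) = e^{iθ_x} a_{s(x)}, where S : ℂ^d ⊗ ℂ^d → ℂ^d ⊗ ℂ^d is the swap of the two tensor factors. Let E := Σ_{x ∈ X} p_x |a_x⟩⟨a_x| and, for each x ∈ X, let ρ_x := ½(|a_x⟩⟨a_x| + |a_{s(x)}⟩⟨a_{s(x)}|). If Tr(E ρ_x) = 1 for every x ∈ X, then p_x = 1 for all x ∈ X, and hence E is the identity operator on ℂ^d ⊗ ℂ^d. -/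

import Mathlib

open scoped InnerProductSpace

/-- Core step of causality (Proposition 1) for density hypercubes. We model
`ℂ^d ⊗ ℂ^d` as `EuclideanSpace ℂ (Fin d × Fin d)`, with the swap `S` of the two
tensor factors given by `(S v)(x, y) = v (y, x)`. Given an orthonormal basis
`(a_x)_{x ∈ X}`, nonnegative weights `p`, an involution `s` with `p ∘ s = p`, and
phases `θ` with `S a_x = e^{iθ_x} a_{s x}`, set `E = Σ_x p_x |a_x⟩⟨a_x|` and
`ρ_x = ½(|a_x⟩⟨a_x| + |a_{s x}⟩⟨a_{s x}|)`. If `Tr(E ρ_x) = 1` for all `x`, then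
`p_x = 1` for all `x`, and `E` is the identity operator. -/
theorem density_hypercubes_causality
    (d : ℕ) (hd : 1 ≤ d) (X : Type*) [Fintype X]
    (a : OrthonormalBasis X ℂ (EuclideanSpace ℂ (Fin d × Fin d)))
    (p : X → ℝ) (hp : ∀ x, 0 ≤ p x)
    (s : X → X) (hs : ∀ x, s (s x) = x) (hps : ∀ x, p (s x) = p x)
    (S : EuclideanSpace ℂ (Fin d × Fin d) →ₗ[ℂ] EuclideanSpace ℂ (Fin d × Fin d))
    (hS : ∀ (v : EuclideanSpace ℂ (Fin d × Fin d)) (i j : Fin d), S v (i, j) = v (j, i))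
    (θ : X → ℝ)
    (hphase : ∀ x, S (a x) = Complex.exp ((θ x : ℂ) * Complex.I) • a (s x))
    (E : EuclideanSpace ℂ (Fin d × Fin d) →ₗ[ℂ] EuclideanSpace ℂ (Fin d × Fin d))
    (hE : ∀ v, E v = ∑ x : X, (p x : ℂ) • (⟪a x, v⟫_ℂ • a x))
    (ρ : X → (EuclideanSpace ℂ (Fin d × Fin d) →ₗ[ℂ] EuclideanSpace ℂ (Fin d × Fin d)))
    (hρ : ∀ x v, ρ x v =
      (1 / 2 : ℂ) • ((⟪a x, v⟫_ℂ • a x) + (⟪a (s x), v⟫_ℂ • a (s x))))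
    (htr : ∀ x : X,
      LinearMap.trace ℂ (EuclideanSpace ℂ (Fin d × Fin d)) (E ∘ₗ ρ x) = 1) :
    (∀ x, p x = 1) ∧ E = LinearMap.id := by
  classical
  have hin : ∀ x y, ⟪a x, a y⟫_ℂ = if x = y then 1 else 0 :=
    fun x y => orthonormal_iff_ite.mp a.orthonormal x y
  have hEa : ∀ y, E (a y) = (p y : ℂ) • a y := by
    intro y
    rw [hE]
    simp [hin]
  have hp1 : ∀ x, p x = 1 := by
    intro x
    have h := htr x
    rw [LinearMap.trace_eq_sum_inner _ a] at h
    simp only [LinearMap.comp_apply, hρ, map_smul, map_add, hEa, inner_smul_right,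
      inner_add_right, hin, hps, mul_add, Finset.sum_add_distrib] at h
    simp at h
    have h2 : (p x : ℂ) = 1 := by linear_combination h
    exact_mod_cast h2
  refine ⟨hp1, a.toBasis.ext fun y => ?_⟩
  simp [hEa, hp1]
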